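/- If the modular element α equals the counit ε, then S(u)⁻¹·u = v·u = a; in particular S(u)⁻¹·u does not depend on the quasitriangular structure R. -/

import Mathlib

open TensorProduct Coalgebra HopfAlgebra

variable {k H : Type*} [Field k] [Ring H] [HopfAlgebra k H]

/-- The antipode of `H`, as a linear map. -/
local notation "𝐒" => HopfAlgebra.antipode (R := k)

/-- Convolution product on the dual of `H`: `(conv f g) h = f h₁ * g h₂`. -/
noncomputable def conv (f g : H →ₗ[k] k) : H →ₗ[k] k :=
  (LinearMap.mul' k k) ∘ₗ (TensorProduct.map f g) ∘ₗ (Coalgebra.comul (R := k))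

/-- `h ↦ f h₁ • h₂`. -/
noncomputable def lT (f : H →ₗ[k] k) : H →ₗ[k] H :=
  (TensorProduct.lid k H).toLinearMap ∘ₗ (f.rTensor H) ∘ₗ (Coalgebra.comul (R := k))

/-- The Sweedler sum `h ↦ f h₁ • p h₃ • g h₂`. -/
noncomputable def sw3 (f : H →ₗ[k] k) (g : H →ₗ[k] H) (p : H →ₗ[k] k) : H →ₗ[k] H :=
  (TensorProduct.lid k H).toLinearMap
    ∘ₗ (TensorProduct.rid k (k ⊗[k] H)).toLinearMap
    ∘ₗ (TensorProduct.map (TensorProduct.map f g) p)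
    ∘ₗ ((Coalgebra.comul (R := k)).rTensor H)
    ∘ₗ (Coalgebra.comul (R := k))

/-- `χ(h) = α(h₂) • S⁻²(h₁)`, the generalized Nakayama automorphism. -/
noncomputable def chiMap (Sinv : H →ₗ[k] H) (f : H →ₗ[k] k) : H →ₗ[k] H :=
  (TensorProduct.rid k H).toLinearMap
    ∘ₗ (TensorProduct.map (Sinv ∘ₗ Sinv) f)
    ∘ₗ (Coalgebra.comul (R := k))

/-- `f(R¹) • R²` for `R = R¹ ⊗ R² ∈ H ⊗ H`. -/
noncomputable def lap (f : H →ₗ[k] k) : (H ⊗[k] H) →ₗ[k] H :=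
  (TensorProduct.lid k H).toLinearMap ∘ₗ (f.rTensor H)

/-- `f(R²) • R¹` for `R = R¹ ⊗ R² ∈ H ⊗ H`. -/
noncomputable def rap (f : H →ₗ[k] k) : (H ⊗[k] H) →ₗ[k] H :=
  (TensorProduct.rid k H).toLinearMap ∘ₗ (LinearMap.lTensor H f)

/-- The Drinfeld element `u = S(R²)R¹`. -/
noncomputable def uElt (Rm : H ⊗[k] H) : H :=
  (LinearMap.mul' k H)
    ((TensorProduct.comm k H H)
      ((LinearMap.lTensor H (HopfAlgebra.antipode (R := k))) Rm))

/-- Convolution product on the dual of `H ⊗ H`. -/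
noncomputable def conv2 (f g : (H ⊗[k] H) →ₗ[k] k) : (H ⊗[k] H) →ₗ[k] k :=
  (LinearMap.mul' k k) ∘ₗ (TensorProduct.map f g) ∘ₗ (Coalgebra.comul (R := k) (A := H ⊗[k] H))

/-- `(h ⊗ l) ↦ σ(h₂ ⊗ l₂) • (l₁ * h₁)`. -/
noncomputable def ac1 (σ : (H ⊗[k] H) →ₗ[k] k) : (H ⊗[k] H) →ₗ[k] H :=
  (TensorProduct.rid k H).toLinearMap
    ∘ₗ (TensorProduct.map ((LinearMap.mul' k H) ∘ₗ (TensorProduct.comm k H H).toLinearMap) σ)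
    ∘ₗ (TensorProduct.tensorTensorTensorComm k H H H H).toLinearMap
    ∘ₗ (TensorProduct.map (Coalgebra.comul (R := k)) (Coalgebra.comul (R := k)))

/-- `(h ⊗ l) ↦ σ(h₁ ⊗ l₁) • (h₂ * l₂)`. -/
noncomputable def ac2 (σ : (H ⊗[k] H) →ₗ[k] k) : (H ⊗[k] H) →ₗ[k] H :=
  (TensorProduct.lid k H).toLinearMap
    ∘ₗ (TensorProduct.map σ (LinearMap.mul' k H))
    ∘ₗ (TensorProduct.tensorTensorTensorComm k H H H H).toLinearMap
    ∘ₗ (TensorProduct.map (Coalgebra.comul (R := k)) (Coalgebra.comul (R := k)))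

/-- `(h ⊗ l) ↦ ρ(h₁ ⊗ l₁) * lam(h₂ * l₂) * τ(h₃ ⊗ l₃)`. -/
noncomputable def trip (lam : H →ₗ[k] k) (ρ τ : (H ⊗[k] H) →ₗ[k] k) : (H ⊗[k] H) →ₗ[k] k :=
  (LinearMap.mul' k k)
    ∘ₗ ((LinearMap.mul' k k).rTensor k)
    ∘ₗ (TensorProduct.map (TensorProduct.map ρ (lam ∘ₗ (LinearMap.mul' k H))) τ)
    ∘ₗ ((TensorProduct.tensorTensorTensorComm k H H H H).toLinearMap.rTensor (H ⊗[k] H))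
    ∘ₗ (TensorProduct.tensorTensorTensorComm k (H ⊗[k] H) H (H ⊗[k] H) H).toLinearMap
    ∘ₗ (TensorProduct.map
          (((Coalgebra.comul (R := k)).rTensor H) ∘ₗ (Coalgebra.comul (R := k)))
          (((Coalgebra.comul (R := k)).rTensor H) ∘ₗ (Coalgebra.comul (R := k))))

/-- `u(h) = σ(h₂ ⊗ S h₁)`. -/
noncomputable def uF (σ : (H ⊗[k] H) →ₗ[k] k) : H →ₗ[k] k :=
  σ ∘ₗ (TensorProduct.comm k H H).toLinearMap
    ∘ₗ ((HopfAlgebra.antipode (R := k)).rTensor H) ∘ₗ (Coalgebra.comul (R := k))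

/-- `v(h) = σ(h₁ ⊗ S h₂)`. -/
noncomputable def vF (σ : (H ⊗[k] H) →ₗ[k] k) : H →ₗ[k] k :=
  σ ∘ₗ (LinearMap.lTensor H (HopfAlgebra.antipode (R := k))) ∘ₗ (Coalgebra.comul (R := k))

/-- `u⁻¹(h) = σ(S²(h₂) ⊗ h₁)`. -/
noncomputable def uinvF (σ : (H ⊗[k] H) →ₗ[k] k) : H →ₗ[k] k :=
  σ ∘ₗ (((HopfAlgebra.antipode (R := k)) ∘ₗ (HopfAlgebra.antipode (R := k))).rTensor H)
    ∘ₗ (TensorProduct.comm k H H).toLinearMap ∘ₗ (Coalgebra.comul (R := k))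

/-- `v⁻¹(h) = σ(S²(h₁) ⊗ h₂)`. -/
noncomputable def vinvF (σ : (H ⊗[k] H) →ₗ[k] k) : H →ₗ[k] k :=
  σ ∘ₗ (((HopfAlgebra.antipode (R := k)) ∘ₗ (HopfAlgebra.antipode (R := k))).rTensor H)
    ∘ₗ (Coalgebra.comul (R := k))

/-- Applying `S` to the first leg of an invertible `R` with `(Δ ⊗ id)R = R₁₃R₂₃` gives a left
inverse of `R`. -/
theorem antipode_rTensor_mul_self (R : H ⊗[k] H)
    (hR : (Coalgebra.comul (R := k)).rTensor H R =
      (((Algebra.TensorProduct.includeLeft : H →ₐ[k] (H ⊗[k] H))).toLinearMap.rTensor H R) *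
      (((Algebra.TensorProduct.includeRight : H →ₐ[k] (H ⊗[k] H))).toLinearMap.rTensor H R))
    (hcounit : lap (Coalgebra.counit (R := k)) R = 1) :
    (𝐒).rTensor H R * R = 1 := by
  have h := congrArg ((LinearMap.mul' k H ∘ₗ (𝐒).rTensor H).rTensor H) hR
  have hl : ∀ P : H ⊗[k] H, (LinearMap.mul' k H ∘ₗ (𝐒).rTensor H).rTensor H
      ((Coalgebra.comul (R := k)).rTensor H P) = 1 ⊗ₜ lap (Coalgebra.counit (R := k)) P := by
    intro P
    induction P with
    | zero => simp
    | add x y hx hy => simp only [map_add, hx, hy, TensorProduct.tmul_add]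
    | tmul x y => simp [lap, Algebra.algebraMap_eq_smul_one, TensorProduct.smul_tmul]
  have hr : ∀ P Q : H ⊗[k] H, (LinearMap.mul' k H ∘ₗ (𝐒).rTensor H).rTensor H
      ((((Algebra.TensorProduct.includeLeft : H →ₐ[k] (H ⊗[k] H))).toLinearMap.rTensor H P) *
      (((Algebra.TensorProduct.includeRight : H →ₐ[k] (H ⊗[k] H))).toLinearMap.rTensor H Q)) =
      (𝐒).rTensor H P * Q := by
    intro P Q
    induction P with
    | zero => simp
    | add x y hx hy => simp only [map_add, add_mul, hx, hy]
    | tmul x y =>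
      induction Q with
      | zero => simp
      | add z w hz hw => simp only [map_add, mul_add, hz, hw]
      | tmul z w => simp
  rw [hl, hr, hcounit] at h
  exact h.symm

/-- Applying `S⁻¹` to the second leg of an `R` with `(id ⊗ Δ)R = R₁₃R₁₂` gives a left
inverse of `R`. -/
theorem antipodeInv_lTensor_mul_self (Sinv : H →ₗ[k] H) (hSinv_l : ∀ h : H, Sinv (𝐒 h) = h)
    (hSinv_r : ∀ h : H, 𝐒 (Sinv h) = h) (R : H ⊗[k] H)
    (hR : (Coalgebra.comul (R := k)).lTensor H R =
      (LinearMap.lTensor H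
        ((Algebra.TensorProduct.includeRight : H →ₐ[k] (H ⊗[k] H))).toLinearMap R) *
      (LinearMap.lTensor H
        ((Algebra.TensorProduct.includeLeft : H →ₐ[k] (H ⊗[k] H))).toLinearMap R))
    (hcounit : rap (Coalgebra.counit (R := k)) R = 1) :
    LinearMap.lTensor H Sinv R * R = 1 := by
  have h := congrArg (LinearMap.lTensor H (Sinv ∘ₗ LinearMap.mul' k H ∘ₗ (𝐒).rTensor H)) hR
  have hone : Sinv 1 = 1 := by
    simpa using hSinv_l 1
  have hl : ∀ P : H ⊗[k] H, LinearMap.lTensor H (Sinv ∘ₗ LinearMap.mul' k H ∘ₗ (𝐒).rTensor H)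
      ((Coalgebra.comul (R := k)).lTensor H P) = rap (Coalgebra.counit (R := k)) P ⊗ₜ 1 := by
    intro P
    induction P with
    | zero => simp
    | add x y hx hy => simp only [map_add, hx, hy, TensorProduct.add_tmul]
    | tmul x y => simp [rap, Algebra.algebraMap_eq_smul_one, hone, TensorProduct.smul_tmul]
  have hr : ∀ P Q : H ⊗[k] H,
      LinearMap.lTensor H (Sinv ∘ₗ LinearMap.mul' k H ∘ₗ (𝐒).rTensor H)
      ((LinearMap.lTensor H
        ((Algebra.TensorProduct.includeRight : H →ₐ[k] (H ⊗[k] H))).toLinearMap P) *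
      (LinearMap.lTensor H
        ((Algebra.TensorProduct.includeLeft : H →ₐ[k] (H ⊗[k] H))).toLinearMap Q)) =
      LinearMap.lTensor H Sinv P * Q := by
    intro P Q
    induction P with
    | zero => simp
    | add x y hx hy => simp only [map_add, add_mul, hx, hy]
    | tmul x y =>
      induction Q with
      | zero => simp
      | add z w hz hw => simp only [map_add, mul_add, hz, hw]
      | tmul z w =>
        have : Sinv (𝐒 w * y) = Sinv y * w := by
          conv_lhs => rw [← hSinv_r y, ← antipode_mul_antidistrib, hSinv_l]
        simp [this]
  rw [hl, hr, hcounit] at h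
  exact h.symm

/-- `h₁ λ(h₂) = λ(h) 1` for a left integral `λ`. -/
theorem rap_comul_of_left_integral (lam : H →ₗ[k] k)
    (hlam : ∀ f : H →ₗ[k] k, conv f lam = f 1 • lam) (h : H) :
    rap lam (Coalgebra.comul (R := k) h) = lam h • (1 : H) := by
  rw [← sub_eq_zero, ← Module.forall_dual_apply_eq_zero_iff k]
  intro f
  have key : ∀ P : H ⊗[k] H, f (rap lam P) = LinearMap.mul' k k (TensorProduct.map f lam P) := by
    intro P
    induction P with
    | zero => simp
    | add x y hx hy => simp only [map_add, hx, hy]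
    | tmul x y => simp [rap, mul_comm]
  have := LinearMap.congr_fun (hlam f) h
  simp only [conv, LinearMap.comp_apply, LinearMap.smul_apply, smul_eq_mul] at this
  rw [map_sub, key, this, map_smul, smul_eq_mul, mul_comm, sub_self]

/-- `h₁ λ(x h₂) = S(x₁) λ(x₂ h)` for a left integral `λ`. -/
theorem rap_mulLeft_comul_of_left_integral (lam : H →ₗ[k] k)
    (hlam : ∀ f : H →ₗ[k] k, conv f lam = f 1 • lam) (x h : H) :
    rap (lam ∘ₗ LinearMap.mulLeft k x) (Coalgebra.comul (R := k) h) =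
      rap (lam ∘ₗ LinearMap.mulRight k h) ((𝐒).rTensor H (Coalgebra.comul (R := k) x)) := by
  let G : H ⊗[k] H → H ⊗[k] (H ⊗[k] H) →ₗ[k] H := fun D ↦
    LinearMap.mul' k H ∘ₗ TensorProduct.map 𝐒 (rap lam ∘ₗ LinearMap.mulRight k D)
  have hG : ∀ D E, G (D + E) = G D + G E := by
    intro D E
    ext
    simp [G, mul_add]
  have hright : ∀ P : H ⊗[k] H, G (Coalgebra.comul (R := k) h)
      (LinearMap.lTensor H (Coalgebra.comul (R := k)) P) =
      rap (lam ∘ₗ LinearMap.mulRight k h) ((𝐒).rTensor H P) := by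
    intro P
    induction P with
    | zero => simp
    | add a b ha hb => simp only [map_add, ha, hb]
    | tmul a b =>
      simp [G, ← Bialgebra.comul_mul, rap_comul_of_left_integral lam hlam]
      simp [rap]
  have hassoc : ∀ (Q : H ⊗[k] H) (c d e : H),
      G (d ⊗ₜ e) (TensorProduct.assoc k H H H (Q ⊗ₜ c)) =
      lam (c * e) • (LinearMap.mul' k H ((𝐒).rTensor H Q) * d) := by
    intro Q c d e
    induction Q with
    | zero => simp
    | add a b ha hb => simp only [map_add, TensorProduct.add_tmul, add_mul, smul_add, ha, hb]
    | tmul a b => simp [G, rap, mul_assoc]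
  have hleft : ∀ (D P : H ⊗[k] H), G D (TensorProduct.assoc k H H H
      ((Coalgebra.comul (R := k)).rTensor H P)) =
      rap (lam ∘ₗ LinearMap.mulLeft k
        (TensorProduct.lid k H ((Coalgebra.counit (R := k)).rTensor H P))) D := by
    intro D P
    induction D with
    | zero => simp [G]
    | add D E hD hE => rw [hG, LinearMap.add_apply, hD, hE, map_add]
    | tmul d e =>
      induction P with
      | zero => simp [rap]
      | add a b ha hb => simp only [map_add, ha, hb]; simp [rap, add_mul, add_smul]
      | tmul a b =>
        rw [LinearMap.rTensor_tmul, hassoc]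
        simp [rap, Algebra.algebraMap_eq_smul_one, smul_smul, mul_comm]
  rw [← hright, ← Coalgebra.coassoc_apply, hleft, Coalgebra.rTensor_counit_comul]
  simp

/-- A slice of a tensor depends on only finitely many values of the functional. -/
theorem exists_finset_rap_congr (T : H ⊗[k] H) :
    ∃ s : Finset H, ∀ f g : H →ₗ[k] k, (∀ x ∈ s, f x = g x) → rap f T = rap g T := by
  classical
  obtain ⟨t, rfl⟩ := TensorProduct.exists_finset T
  refine ⟨t.image Prod.snd, fun f g hfg ↦ ?_⟩
  rw [map_sum, map_sum]
  refine Finset.sum_congr rfl fun i hi ↦ ?_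
  simp [rap, hfg i.2 (Finset.mem_image_of_mem _ hi)]

/-- Density of the rational part: an identity between slices against `λ(· h)` extends to slices
against any functional. -/
theorem rap_eq_of_forall_rap_mulRight (lam : H →ₗ[k] k)
    (hdense : ∀ (f : H →ₗ[k] k) (s : Finset H), ∃ h : H, ∀ x ∈ s, lam (x * h) = f x)
    (T : H ⊗[k] H) (b : H)
    (hT : ∀ h : H, rap (lam ∘ₗ LinearMap.mulRight k h) T = lam h • b) (f : H →ₗ[k] k) :
    rap f T = f 1 • b := by
  classical
  obtain ⟨s, hs⟩ := exists_finset_rap_congr T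
  obtain ⟨h, hh⟩ := hdense f (insert 1 s)
  have h1 : lam h = f 1 := by simpa using hh 1 (Finset.mem_insert_self _ _)
  rw [← h1, ← hT h]
  exact hs _ _ fun x hx ↦ by simpa using (hh x (Finset.mem_insert_of_mem hx)).symm

/-- `S(u) = R¹ S(R²)`. -/
theorem antipode_uElt (Sinv : H →ₗ[k] H) (hSinv_r : ∀ h : H, 𝐒 (Sinv h) = h) (R : H ⊗[k] H)
    (hR : (𝐒).rTensor H R = LinearMap.lTensor H Sinv R) :
    𝐒 (uElt R) = LinearMap.mul' k H (LinearMap.lTensor H 𝐒 R) := by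
  have h := congrArg (LinearMap.mul' k H ∘ₗ LinearMap.lTensor H (𝐒 ∘ₗ 𝐒)) hR
  have hl : ∀ P : H ⊗[k] H, (LinearMap.mul' k H ∘ₗ LinearMap.lTensor H (𝐒 ∘ₗ 𝐒))
      ((𝐒).rTensor H P) = 𝐒 (uElt P) := by
    intro P
    simp only [uElt]
    induction P with
    | zero => simp
    | add x y hx hy => simp only [map_add, hx, hy]
    | tmul x y => simp [antipode_mul_antidistrib]
  have hr : ∀ P : H ⊗[k] H, (LinearMap.mul' k H ∘ₗ LinearMap.lTensor H (𝐒 ∘ₗ 𝐒))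
      (LinearMap.lTensor H Sinv P) = LinearMap.mul' k H (LinearMap.lTensor H 𝐒 P) := by
    intro P
    induction P with
    | zero => simp
    | add x y hx hy => simp only [map_add, hx, hy]
    | tmul x y => simp [hSinv_r]
  rwa [hl, hr] at h

/-- If `u = S(R²)R¹` implements `S²` and `RU = 1`, then `S⁻¹(U²)U¹` is the inverse of `u`. -/
theorem mul_antipodeInv_comm_eq (Sinv : H →ₗ[k] H) (hSinv_r : ∀ h : H, 𝐒 (Sinv h) = h)
    (R U : H ⊗[k] H) (hRU : R * U = 1) (u' : H) (hu_l : u' * uElt R = 1)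
    (hS2u : ∀ h : H, 𝐒 (𝐒 h) = uElt R * h * u') :
    LinearMap.mul' k H (TensorProduct.comm k H H (LinearMap.lTensor H Sinv U)) = u' := by
  have hcomm (x : H) : uElt R * x = 𝐒 (𝐒 x) * uElt R := by
    rw [hS2u, mul_assoc, hu_l, mul_one]
  have hmul (x y : H) (P : H ⊗[k] H) : 𝐒 y * uElt P * x = uElt (P * (x ⊗ₜ[k] y)) := by
    induction P with
    | zero => simp [uElt]
    | add P Q hP hQ =>
      simp only [uElt, map_add, mul_add, add_mul] at hP hQ ⊢
      rw [hP, hQ]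
    | tmul p q => simp [uElt, antipode_mul_antidistrib, mul_assoc]
  have key : ∀ P : H ⊗[k] H, uElt R *
      LinearMap.mul' k H (TensorProduct.comm k H H (LinearMap.lTensor H Sinv P)) =
      uElt (R * P) := by
    intro P
    induction P with
    | zero => simp [uElt]
    | add P Q hP hQ =>
      simp only [map_add, mul_add, hP, hQ]
      simp [uElt]
    | tmul x y =>
      simp only [LinearMap.lTensor_tmul, TensorProduct.comm_tmul, LinearMap.mul'_apply]
      rw [← hmul, ← mul_assoc, hcomm, hSinv_r]
  have h := key U
  rw [hRU] at h
  have h1 : uElt (1 : H ⊗[k] H) = 1 := by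
    simp [uElt, Algebra.TensorProduct.one_def]
  rw [h1] at h
  calc _ = u' * uElt R * _ := by rw [hu_l, one_mul]
    _ = u' := by rw [mul_assoc, h, mul_one]

/-- In the unimodular case the antipode of the modular element factors through `R` and its
inverse `U`: `S(a) = R¹ S(R²) S⁻¹(U²) U¹`. -/
theorem antipode_modular_eq (lam : H →ₗ[k] k)
    (hlam : ∀ f : H →ₗ[k] k, conv f lam = f 1 • lam)
    (a : H) (ha_mod : ∀ h : H, lT lam h = lam h • (𝐒 a))
    (Sinv : H →ₗ[k] H) (hSinv_r : ∀ h : H, 𝐒 (Sinv h) = h)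
    (htrace : ∀ h l : H, lam (l * h) = lam (Sinv (Sinv h) * l))
    (R U : H ⊗[k] H)
    (hqt4 : ∀ h : H, (TensorProduct.comm k H H) (Coalgebra.comul (R := k) h) =
      R * (Coalgebra.comul (R := k) h) * U)
    (hdense : ∀ (f : H →ₗ[k] k) (s : Finset H), ∃ h : H, ∀ x ∈ s, lam (x * h) = f x) :
    𝐒 a = LinearMap.mul' k H (LinearMap.lTensor H 𝐒 R) *
      LinearMap.mul' k H (TensorProduct.comm k H H (LinearMap.lTensor H Sinv U)) := by
  obtain ⟨r, rfl⟩ := TensorProduct.exists_finset R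
  obtain ⟨s, rfl⟩ := TensorProduct.exists_finset U
  have hconj (f : H →ₗ[k] k) (x y : H) (P : H ⊗[k] H) :
      rap f ((x ⊗ₜ 1) * P * (y ⊗ₜ 1)) = x * rap f P * y := by
    induction P with
    | zero => simp
    | add P Q hP hQ => simp only [map_add, mul_add, add_mul, hP, hQ]
    | tmul p q => simp [rap]
  have hslice (i j : H × H) (P : H ⊗[k] H) :
      rap lam ((i.1 ⊗ₜ i.2) * P * (j.1 ⊗ₜ j.2)) =
      i.1 * rap (lam ∘ₗ LinearMap.mulLeft k (Sinv (Sinv j.2) * i.2)) P * j.1 := by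
    induction P with
    | zero => simp
    | add P Q hP hQ => simp only [map_add, mul_add, add_mul, hP, hQ]
    | tmul p q =>
      have h : lam (i.2 * (q * j.2)) = lam (Sinv (Sinv j.2) * (i.2 * q)) := by
        rw [← mul_assoc, htrace]
      simp [rap, h, mul_assoc]
  have hflip (P : H ⊗[k] H) : rap lam (TensorProduct.comm k H H P) =
      TensorProduct.lid k H (lam.rTensor H P) := by
    induction P with
    | zero => simp
    | add P Q hP hQ => simp only [map_add, hP, hQ]
    | tmul p q => simp [rap]
  have hT := rap_eq_of_forall_rap_mulRight lam hdense
    (∑ i ∈ r, ∑ j ∈ s, (i.1 ⊗ₜ 1) *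
      (𝐒).rTensor H (Coalgebra.comul (R := k) (Sinv (Sinv j.2) * i.2)) * (j.1 ⊗ₜ 1)) (𝐒 a)
    (fun h ↦ by
      rw [← ha_mod h]
      change _ = TensorProduct.lid k H (lam.rTensor H (Coalgebra.comul (R := k) h))
      rw [← hflip, hqt4]
      simp only [Finset.sum_mul, Finset.mul_sum, map_sum, hslice, hconj,
        rap_mulLeft_comul_of_left_integral lam hlam]
      exact Finset.sum_comm)
    (Coalgebra.counit (R := k))
  have hcounit (x : H) : rap (Coalgebra.counit (R := k))
      ((𝐒).rTensor H (Coalgebra.comul (R := k) x)) = 𝐒 x := by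
    have key (P : H ⊗[k] H) : rap (Coalgebra.counit (R := k)) ((𝐒).rTensor H P) =
        𝐒 (TensorProduct.rid k H (LinearMap.lTensor H (Coalgebra.counit (R := k)) P)) := by
      induction P with
      | zero => simp
      | add P Q hP hQ => simp only [map_add, hP, hQ]
      | tmul p q => simp [rap]
    simp [key]
  rw [Bialgebra.counit_one, one_smul] at hT
  rw [← hT]
  simp only [map_sum, hconj, hcounit, antipode_mul_antidistrib, hSinv_r, LinearMap.lTensor_tmul,
    TensorProduct.comm_tmul, LinearMap.mul'_apply, Finset.sum_mul, Finset.mul_sum]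
  rw [Finset.sum_comm]
  simp only [mul_assoc]

/-- If the modular element $α$ equals the counit $ε$, then
$S(u)^{-1} u = v u = a$; in particular $S(u)^{-1}u$ does not depend on $R$. -/
theorem v_mul_u_eq_a_of_alpha_eq_counit
    (lam : H →ₗ[k] k) (hlam_ne : lam ≠ 0)
    (hlam_int : ∀ f : H →ₗ[k] k, conv f lam = f 1 • lam)
    (a : H) (ha_ne : a ≠ 0) (ha_grp : Coalgebra.comul (R := k) a = a ⊗ₜ[k] a)
    (ha_mod : ∀ h : H, lT lam h = lam h • (𝐒 a))
    (ha_S2 : ∀ h : H, lam (𝐒 (𝐒 h)) = lam (a * h * 𝐒 a))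
    (Sinv : H →ₗ[k] H) (hSinv_l : ∀ h : H, Sinv (𝐒 h) = h)
    (hSinv_r : ∀ h : H, 𝐒 (Sinv h) = h)
    (α : H →ₐ[k] k)
    (hα : ∀ h l : H, lam (l * h) = lam ((chiMap Sinv α.toLinearMap h) * l))
    (R U : H ⊗[k] H) (hRU : R * U = 1) (hUR : U * R = 1)
    (hqt4 : ∀ h : H, (TensorProduct.comm k H H) (Coalgebra.comul (R := k) h) =
      R * (Coalgebra.comul (R := k) h) * U)
    (hqt1 : (Coalgebra.comul (R := k)).rTensor H R =
      (((Algebra.TensorProduct.includeLeft : H →ₐ[k] (H ⊗[k] H))).toLinearMap.rTensor H R) *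
      (((Algebra.TensorProduct.includeRight : H →ₐ[k] (H ⊗[k] H))).toLinearMap.rTensor H R))
    (hqt2 : (Coalgebra.comul (R := k)).lTensor H R =
      (LinearMap.lTensor H ((Algebra.TensorProduct.includeRight : H →ₐ[k] (H ⊗[k] H))).toLinearMap R) *
      (LinearMap.lTensor H ((Algebra.TensorProduct.includeLeft : H →ₐ[k] (H ⊗[k] H))).toLinearMap R))
    (hqt3l : lap (Coalgebra.counit (R := k)) R = 1)
    (hqt3r : rap (Coalgebra.counit (R := k)) R = 1)
    (u' : H) (hu_r : uElt R * u' = 1) (hu_l : u' * uElt R = 1)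
    (hS2u : ∀ h : H, 𝐒 (𝐒 h) = uElt R * h * u')
    (hΔu : Coalgebra.comul (R := k) (uElt R) =
      ((uElt R) ⊗ₜ[k] (uElt R)) * (U * ((TensorProduct.comm k H H) U)))
    (v : H) (hv_r : 𝐒 (uElt R) * v = 1) (hv_l : v * 𝐒 (uElt R) = 1)
    (hdense : ∀ (f : H →ₗ[k] k) (s : Finset H), ∃ h : H, ∀ x ∈ s, lam (x * h) = f x)
    (hαε : α.toLinearMap = Coalgebra.counit (R := k)) :
    v * uElt R = a := by
  have htrace (h l : H) : lam (l * h) = lam (Sinv (Sinv h) * l) := by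
    have key (P : H ⊗[k] H) : TensorProduct.rid k H
        (TensorProduct.map (Sinv ∘ₗ Sinv) (Coalgebra.counit (R := k)) P) =
        Sinv (Sinv (TensorProduct.rid k H
          (LinearMap.lTensor H (Coalgebra.counit (R := k)) P))) := by
      induction P with
      | zero => simp
      | add P Q hP hQ => simp only [map_add, hP, hQ]
      | tmul p q => simp
    rw [hα h l, hαε]
    simp [chiMap, key]
  have hSR := antipode_rTensor_mul_self R hqt1 hqt3l
  have hSiR := antipodeInv_lTensor_mul_self Sinv hSinv_l hSinv_r R hqt2 hqt3r
  have hSa := antipode_modular_eq lam hlam_int a ha_mod Sinv hSinv_r htrace R U hqt4 hdense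
  rw [← antipode_uElt Sinv hSinv_r R
      ((left_inv_eq_right_inv hSR hRU).trans (left_inv_eq_right_inv hSiR hRU).symm),
    mul_antipodeInv_comm_eq Sinv hSinv_r R U hRU u' hu_l hS2u] at hSa
  have hcounit_a : Coalgebra.counit (R := k) a = 1 := by
    have h := Coalgebra.rTensor_counit_comul (R := k) a
    rw [ha_grp, LinearMap.rTensor_tmul] at h
    have h' := congrArg (TensorProduct.lid k H) h
    simp only [TensorProduct.lid_tmul, one_smul] at h'
    exact smul_left_injective k ha_ne (by simpa using h')
  have hSa_a : 𝐒 a * a = 1 := by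
    have h := mul_antipode_rTensor_comul_apply (R := k) a
    rwa [ha_grp, LinearMap.rTensor_tmul, LinearMap.mul'_apply, hcounit_a, map_one] at h
  have hS2 : 𝐒 (𝐒 (uElt R)) = uElt R := by
    rw [hS2u, mul_assoc, hu_r, mul_one]
  have hcomm : uElt R * 𝐒 (uElt R) = 𝐒 (uElt R) * uElt R := by
    have h := hS2u (𝐒 (uElt R))
    rw [hS2] at h
    calc uElt R * 𝐒 (uElt R) = uElt R * 𝐒 (uElt R) * u' * uElt R := by
          rw [mul_assoc _ u', hu_l, mul_one]
      _ = 𝐒 (uElt R) * uElt R := by rw [← h]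
  have hinv : v * uElt R * 𝐒 a = 1 := by
    rw [hSa, mul_assoc, ← mul_assoc (uElt R), hcomm, mul_assoc (𝐒 (uElt R)), hu_r, mul_one, hv_l]
  exact left_inv_eq_right_inv hinv hSa_a
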